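/- Let ξ ∈ C¹([0,∞)), F ∈ C¹(ℝ) with F' ≥ c > 0, H ∈ C¹(ℝ), and let u be a classical solution of du = ∂_x(F(∂_x u)) dt + H(∂_x u) dξ on 𝕋 × [0,∞). Then for all t ≥ 0: ∥∂_x u(·,t)∥_{L²(𝕋)} ≤ e^{−4π² c t} · ∥∂_x u(·,0)∥_{L²(𝕋)}, where 4π² is the first nonzero eigenvalue of −d²/dx² on 𝕋 = ℝ/ℤ. -/

import Mathlib

open Set MeasureTheory intervalIntegral Real

/-- A classical solution of `du = ∂ₓ(F(∂ₓu)) dt + H(∂ₓu) dξ` on `𝕋 × I`, where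
`𝕋 = ℝ/ℤ` is realized as `1`-periodic functions of `x ∈ ℝ`: a function `u`,
`C²` in `x` and `C¹` in `t` (on `I`) with `∂ₜ∂ₓu` continuous, with space derivatives
`ux`, `uxx`, time derivative `ut` and mixed derivative `utx`, satisfying
`∂ₜu = ∂ₓ(F(∂ₓu)) + H(∂ₓu)·ξ'(t)` pointwise. -/
structure IsClassicalSolution (I : Set ℝ) (ξ F H : ℝ → ℝ)
    (u ux uxx ut utx : ℝ → ℝ → ℝ) : Prop where
  periodic : ∀ x t, u (x + 1) t = u x t
  deriv_x : ∀ x : ℝ, ∀ t ∈ I, HasDerivAt (fun y => u y t) (ux x t) x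
  deriv_xx : ∀ x : ℝ, ∀ t ∈ I, HasDerivAt (fun y => ux y t) (uxx x t) x
  deriv_t : ∀ x : ℝ, ∀ t ∈ I, HasDerivWithinAt (fun s => u x s) (ut x t) I t
  deriv_tx : ∀ x : ℝ, ∀ t ∈ I, HasDerivWithinAt (fun s => ux x s) (utx x t) I t
  cont_u : ContinuousOn (fun p : ℝ × ℝ => u p.1 p.2) (Set.univ ×ˢ I)
  cont_ux : ContinuousOn (fun p : ℝ × ℝ => ux p.1 p.2) (Set.univ ×ˢ I)
  cont_uxx : ContinuousOn (fun p : ℝ × ℝ => uxx p.1 p.2) (Set.univ ×ˢ I)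
  cont_ut : ContinuousOn (fun p : ℝ × ℝ => ut p.1 p.2) (Set.univ ×ˢ I)
  cont_utx : ContinuousOn (fun p : ℝ × ℝ => utx p.1 p.2) (Set.univ ×ˢ I)
  pde : ∀ x : ℝ, ∀ t ∈ I,
    ut x t = deriv (fun y => F (ux y t)) x + H (ux x t) * deriv ξ t

open scoped Topology

/-- Differentiation under the integral sign over a compact interval, for a jointly continuous
derivative. -/
theorem hasDerivAt_intervalIntegral_of_continuousOn {f f' : ℝ → ℝ → ℝ} {s : Set ℝ} (hs : IsOpen s)
    (hf : ContinuousOn (fun p : ℝ × ℝ => f p.1 p.2) (univ ×ˢ s))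
    (hf' : ContinuousOn (fun p : ℝ × ℝ => f' p.1 p.2) (univ ×ˢ s))
    (hff' : ∀ x, ∀ r ∈ s, HasDerivAt (f x) (f' x r) r) (a b : ℝ) {t : ℝ} (ht : t ∈ s) :
    HasDerivAt (fun r => ∫ x in a..b, f x r) (∫ x in a..b, f' x t) t := by
  have slice : ∀ {g : ℝ → ℝ → ℝ}, ContinuousOn (fun p : ℝ × ℝ => g p.1 p.2) (univ ×ˢ s) →
      ∀ r ∈ s, Continuous fun x => g x r := fun hg r hr =>
    hg.comp_continuous (f := fun x : ℝ => (x, r)) (by fun_prop) fun x => ⟨mem_univ x, hr⟩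
  obtain ⟨K, hK, hKs, hKc⟩ := local_compact_nhds (hs.mem_nhds ht)
  obtain ⟨C, hC⟩ := (isCompact_uIcc (a := a) (b := b)).prod hKc |>.exists_bound_of_continuousOn
    (hf'.mono (prod_mono (subset_univ _) hKs))
  refine (intervalIntegral.hasDerivAt_integral_of_dominated_loc_of_deriv_le (F := fun r x => f x r)
    (F' := fun r x => f' x r) (bound := fun _ => C) hK ?_ ?_ ?_ ?_ ?_ ?_).2
  · filter_upwards [hs.mem_nhds ht] with r hr
    exact (slice hf r hr).aestronglyMeasurable
  · exact (slice hf t ht).intervalIntegrable _ _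
  · exact (slice hf' t ht).aestronglyMeasurable
  · exact .of_forall fun x hx r hr => hC (x, r) ⟨uIoc_subset_uIcc hx, hr⟩
  · exact intervalIntegrable_const
  · exact .of_forall fun x _ r hr => hff' x r (hKs hr)

/-- **Wirtinger's inequality** on the unit interval with periodic boundary conditions. -/
theorem four_pi_sq_mul_integral_sq_le {g g' : ℝ → ℝ} (hg : ∀ x, HasDerivAt g (g' x) x)
    (hg' : Continuous g') (hper : g 1 = g 0) (hmean : ∫ x in (0 : ℝ)..1, g x = 0) :
    4 * π ^ 2 * ∫ x in (0 : ℝ)..1, g x ^ 2 ≤ ∫ x in (0 : ℝ)..1, g' x ^ 2 := by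
  have hgc : Continuous g := continuous_iff_continuousAt.2 fun x => (hg x).continuousAt
  have parseval : ∀ {h : ℝ → ℝ}, Continuous h →
      HasSum (fun n => ‖fourierCoeffOn zero_lt_one (fun x => (h x : ℂ)) n‖ ^ 2)
        (∫ x in (0 : ℝ)..1, h x ^ 2) := by
    intro h hh
    have hL2 : MemLp (fun x => (h x : ℂ)) 2 (volume.restrict (Ioc (0 : ℝ) 1)) := by
      rw [memLp_two_iff_integrable_sq_norm (by fun_prop)]
      have : Continuous fun x => ‖(h x : ℂ)‖ ^ 2 := by fun_prop
      exact (this.integrableOn_Icc (a := 0) (b := 1)).mono_set Ioc_subset_Icc_self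
    simpa using hasSum_sq_fourierCoeffOn zero_lt_one hL2
  refine hasSum_le (fun n => ?_) ((parseval hgc).mul_left (4 * π ^ 2)) (parseval hg')
  rcases eq_or_ne n 0 with rfl | hn
  · have : fourierCoeffOn zero_lt_one (fun x => (g x : ℂ)) 0 = 0 := by
      simp [fourierCoeffOn_eq_integral, intervalIntegral.integral_ofReal, hmean]
    rw [this]
    simp
  · rw [fourierCoeffOn_of_hasDerivAt zero_lt_one hn (fun x _ => (hg x).ofReal_comp)
      (by exact (Continuous.intervalIntegrable (by fun_prop) _ _))]
    have h1 : (1 : ℝ) ≤ (n : ℝ) ^ 2 := by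
      exact_mod_cast Int.one_le_abs (pow_ne_zero 2 hn) |>.trans_eq (abs_sq n)
    have hn0 : (n : ℝ) ≠ 0 := by exact_mod_cast hn
    simp only [hper, sub_self, mul_zero, zero_sub, norm_mul, norm_div, norm_neg, norm_one,
      Complex.norm_I, Complex.norm_real, Complex.norm_intCast, Complex.norm_ofNat, sub_zero,
      Complex.ofReal_zero, Complex.ofReal_one, mul_pow, div_pow, one_mul, sq_abs, norm_eq_abs,
      one_pow, mul_one]
    set A := ‖fourierCoeffOn zero_lt_one (fun x => (g' x : ℂ)) n‖ ^ 2
    have hA : 0 ≤ A := by positivity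
    have : 4 * π ^ 2 * (1 / (2 ^ 2 * π ^ 2 * (n : ℝ) ^ 2) * A) = A / (n : ℝ) ^ 2 := by
      field_simp
      norm_num
    rw [this]
    exact div_le_self hA h1

/-- Multiplicative form of Grönwall's inequality for a nonincreasing linear differential
inequality. -/
theorem le_exp_neg_mul_of_deriv_le {E E' : ℝ → ℝ} {k : ℝ} (hE : ContinuousOn E (Ici 0))
    (hE' : ∀ t, 0 < t → HasDerivAt E (E' t) t) (hle : ∀ t, 0 < t → E' t ≤ -k * E t)
    {t : ℝ} (ht : 0 ≤ t) : E t ≤ exp (-(k * t)) * E 0 := by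
  have hd : ∀ r, 0 < r → HasDerivAt (fun r => exp (k * r) * E r)
      (exp (k * r) * (k * 1) * E r + exp (k * r) * E' r) r := fun r hr =>
    (((hasDerivAt_id r).const_mul k).exp).mul (hE' r hr)
  have hanti : AntitoneOn (fun r => exp (k * r) * E r) (Ici 0) := by
    refine antitoneOn_of_deriv_nonpos (convex_Ici 0) (by fun_prop) ?_ ?_
    · rw [interior_Ici]
      exact fun r hr => (hd r hr).differentiableAt.differentiableWithinAt
    · rw [interior_Ici]
      intro r hr
      rw [(hd r hr).deriv]
      nlinarith [hle r hr, exp_pos (k * r)]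
  have h := hanti (mem_Ici.2 le_rfl) ht ht
  simp only [mul_zero, exp_zero, one_mul] at h
  rw [exp_neg, inv_mul_eq_div, le_div_iff₀ (exp_pos _)]
  linarith

namespace IsClassicalSolution

variable {ξ F H : ℝ → ℝ} {u ux uxx ut utx : ℝ → ℝ → ℝ}

theorem continuous_slice {I : Set ℝ} {g : ℝ → ℝ → ℝ}
    (hg : ContinuousOn (fun p : ℝ × ℝ => g p.1 p.2) (univ ×ˢ I)) {t : ℝ} (ht : t ∈ I) :
    Continuous fun x => g x t :=
  hg.comp_continuous (f := fun x : ℝ => (x, t)) (by fun_prop) fun x => ⟨mem_univ x, ht⟩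

theorem ux_add_one {I : Set ℝ} (hu : IsClassicalSolution I ξ F H u ux uxx ut utx) {t : ℝ}
    (ht : t ∈ I) (x : ℝ) : ux (x + 1) t = ux x t := by
  have h := (hu.deriv_x (x + 1) t ht).comp_add_const x 1
  simp only [hu.periodic] at h
  exact h.unique (hu.deriv_x x t ht)

theorem ut_add_one (hu : IsClassicalSolution (Ici 0) ξ F H u ux uxx ut utx) {t : ℝ}
    (ht : 0 ≤ t) (x : ℝ) : ut (x + 1) t = ut x t := by
  have h := hu.deriv_t (x + 1) t ht
  simp only [hu.periodic] at h
  exact (uniqueDiffOn_Ici 0 t ht).eq_deriv _ h (hu.deriv_t x t ht)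

theorem integral_ux (hu : IsClassicalSolution (Ici 0) ξ F H u ux uxx ut utx) {t : ℝ}
    (ht : 0 ≤ t) (a b : ℝ) : ∫ x in a..b, ux x t = u b t - u a t :=
  integral_eq_sub_of_hasDerivAt (fun x _ => hu.deriv_x x t ht)
    ((continuous_slice hu.cont_ux ht).intervalIntegrable _ _)

/-- The mixed derivatives of a classical solution commute. -/
theorem hasDerivAt_ut (hu : IsClassicalSolution (Ici 0) ξ F H u ux uxx ut utx) {t : ℝ}
    (ht : 0 < t) (x : ℝ) : HasDerivAt (fun y => ut y t) (utx x t) x := by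
  have key : ∀ y, ut y t = ut 0 t + ∫ z in (0 : ℝ)..y, utx z t := by
    intro y
    have h1 := hasDerivAt_intervalIntegral_of_continuousOn isOpen_Ioi
      (hu.cont_ux.mono (prod_mono_right Ioi_subset_Ici_self))
      (hu.cont_utx.mono (prod_mono_right Ioi_subset_Ici_self))
      (fun z r hr => (hu.deriv_tx z r (Ioi_subset_Ici_self hr)).hasDerivAt (Ici_mem_nhds hr)) 0 y ht
    have h2 := ((hu.deriv_t y t ht.le).hasDerivAt (Ici_mem_nhds ht)).sub
      ((hu.deriv_t 0 t ht.le).hasDerivAt (Ici_mem_nhds ht))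
    have h3 := h2.congr_of_eventuallyEq (f₁ := fun r => ∫ z in (0 : ℝ)..y, ux z r) (by
      filter_upwards [Ioi_mem_nhds ht] with r hr
      exact hu.integral_ux (le_of_lt hr) 0 y)
    linarith [h1.unique h3]
  rw [funext key]
  exact ((continuous_slice hu.cont_utx ht.le).integral_hasStrictDerivAt 0 x).hasDerivAt.const_add _

/-- The noise term does not contribute to the energy balance. -/
theorem integral_uxx_mul_comp_ux (hu : IsClassicalSolution (Ici 0) ξ F H u ux uxx ut utx)
    {G : ℝ → ℝ} (hG : Continuous G) {t : ℝ} (ht : 0 ≤ t) :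
    ∫ x in (0 : ℝ)..1, G (ux x t) * uxx x t = 0 := by
  have hux := continuous_slice hu.cont_ux ht
  have huxx := continuous_slice hu.cont_uxx ht
  have hper : ux 1 t = ux 0 t := by simpa using hu.ux_add_one ht 0
  have h := integral_eq_sub_of_hasDerivAt (a := 0) (b := 1)
    (f := fun x => ∫ r in (0 : ℝ)..ux x t, G r) (f' := fun x => G (ux x t) * uxx x t)
    (fun x _ => HasDerivAt.comp (h₂ := fun y => ∫ r in (0 : ℝ)..y, G r) x
      (hG.integral_hasStrictDerivAt 0 (ux x t)).hasDerivAt (hu.deriv_xx x t ht))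
    (((hG.comp hux).mul huxx).intervalIntegrable _ _)
  rw [h, hper, sub_self]

/-- The energy dissipation identity for the gradient. -/
theorem integral_ux_mul_utx (hu : IsClassicalSolution (Ici 0) ξ F H u ux uxx ut utx)
    (hF : ContDiff ℝ 1 F) (hH : Continuous H) {t : ℝ} (ht : 0 < t) :
    ∫ x in (0 : ℝ)..1, ux x t * utx x t = -∫ x in (0 : ℝ)..1, deriv F (ux x t) * uxx x t ^ 2 := by
  have hux := continuous_slice hu.cont_ux ht.le
  have huxx := continuous_slice hu.cont_uxx ht.le
  have hutx := continuous_slice hu.cont_utx ht.le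
  have hF' : Continuous (deriv F) := hF.continuous_deriv le_rfl
  have hper : ux 1 t = ux 0 t := by simpa using hu.ux_add_one ht.le 0
  have hper' : ut 1 t = ut 0 t := by simpa using hu.ut_add_one ht.le 0
  rw [integral_mul_deriv_eq_deriv_mul (fun x _ => hu.deriv_xx x t ht.le)
    (fun x _ => hu.hasDerivAt_ut ht x) (huxx.intervalIntegrable _ _)
    (hutx.intervalIntegrable _ _), hper, hper', sub_self, zero_sub]
  have hpde : ∀ x, uxx x t * ut x t =
      deriv F (ux x t) * uxx x t ^ 2 + deriv ξ t * (H (ux x t) * uxx x t) := by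
    intro x
    have hd : HasDerivAt (fun y => F (ux y t)) (deriv F (ux x t) * uxx x t) x :=
      ((hF.differentiable one_ne_zero).differentiableAt.hasDerivAt).comp x (hu.deriv_xx x t ht.le)
    rw [hu.pde x t ht.le, hd.deriv]
    ring
  simp only [hpde]
  rw [intervalIntegral.integral_add (Continuous.intervalIntegrable (by fun_prop) _ _)
    (Continuous.intervalIntegrable (by fun_prop) _ _), intervalIntegral.integral_const_mul,
    hu.integral_uxx_mul_comp_ux hH ht.le, mul_zero, add_zero]

theorem hasDerivAt_energy (hu : IsClassicalSolution (Ici 0) ξ F H u ux uxx ut utx)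
    (hF : ContDiff ℝ 1 F) (hH : Continuous H) {t : ℝ} (ht : 0 < t) :
    HasDerivAt (fun s => ∫ x in (0 : ℝ)..1, ux x s ^ 2)
      (-2 * ∫ x in (0 : ℝ)..1, deriv F (ux x t) * uxx x t ^ 2) t := by
  have hux := hu.cont_ux.mono (prod_mono_right (Ioi_subset_Ici_self (a := (0 : ℝ))))
  have hutx := hu.cont_utx.mono (prod_mono_right (Ioi_subset_Ici_self (a := (0 : ℝ))))
  have h := hasDerivAt_intervalIntegral_of_continuousOn (f := fun x s => ux x s ^ 2)
    (f' := fun x s => 2 * (ux x s * utx x s)) isOpen_Ioi (hux.pow 2)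
    ((hux.mul hutx).const_mul 2)
    (fun x r hr =>
      (((hu.deriv_tx x r (Ioi_subset_Ici_self hr)).hasDerivAt (Ici_mem_nhds hr)).fun_pow
        2).congr_deriv (by push_cast; ring)) 0 1 ht
  rw [intervalIntegral.integral_const_mul, hu.integral_ux_mul_utx hF hH ht] at h
  convert h using 1
  ring

theorem continuousOn_energy (hu : IsClassicalSolution (Ici 0) ξ F H u ux uxx ut utx) :
    ContinuousOn (fun s => ∫ x in (0 : ℝ)..1, ux x s ^ 2) (Ici 0) := by
  have hext : Continuous fun p : ℝ × ℝ => ux p.2 (max p.1 0) ^ 2 :=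
    (hu.cont_ux.comp_continuous (f := fun p : ℝ × ℝ => (p.2, max p.1 0)) (by fun_prop)
      fun p => ⟨mem_univ _, mem_Ici.2 (le_max_right _ _)⟩).pow 2
  refine (continuous_parametric_intervalIntegral_of_continuous' (μ := volume)
    (f := fun s x => ux x (max s 0) ^ 2) hext 0 1).continuousOn.congr fun s hs => ?_
  simp only [max_eq_left (mem_Ici.1 hs)]

end IsClassicalSolution

/-- Let `ξ ∈ C¹([0,∞))`, `F ∈ C¹(ℝ)` with `F' ≥ c > 0`, `H ∈ C¹(ℝ)`,
and let `u` be a classical solution of `du = ∂ₓ(F(∂ₓu)) dt + H(∂ₓu) dξ` on `𝕋 × [0,∞)`.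
Then for all `t ≥ 0`:
`‖∂ₓu(·,t)‖_{L²(𝕋)} ≤ e^{-4π²ct} ‖∂ₓu(·,0)‖_{L²(𝕋)}`, where `4π²` is the first
nonzero eigenvalue of `-d²/dx²` on `𝕋 = ℝ/ℤ`. -/
theorem gradient_L2_exponential_decay
    (ξ F H : ℝ → ℝ) (hξ : ContDiff ℝ 1 ξ) (hF : ContDiff ℝ 1 F)
    (c : ℝ) (hc : 0 < c) (hF' : ∀ r, c ≤ deriv F r) (hH : ContDiff ℝ 1 H)
    (u ux uxx ut utx : ℝ → ℝ → ℝ)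
    (hu : IsClassicalSolution (Set.Ici 0) ξ F H u ux uxx ut utx) :
    ∀ t : ℝ, 0 ≤ t →
      Real.sqrt (∫ x in (0 : ℝ)..1, (ux x t) ^ 2)
        ≤ Real.exp (-(4 * π ^ 2 * c * t)) * Real.sqrt (∫ x in (0 : ℝ)..1, (ux x 0) ^ 2) := by
  intro t ht
  have hH' := hH.continuous
  have hF'c : Continuous (deriv F) := hF.continuous_deriv le_rfl
  have hdecay := le_exp_neg_mul_of_deriv_le (k := 8 * π ^ 2 * c) hu.continuousOn_energy
    (fun s hs => hu.hasDerivAt_energy hF hH' hs) (fun s hs => by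
      have hux := IsClassicalSolution.continuous_slice hu.cont_ux (mem_Ici.2 hs.le)
      have huxx := IsClassicalSolution.continuous_slice hu.cont_uxx (mem_Ici.2 hs.le)
      have hpoincare := four_pi_sq_mul_integral_sq_le (fun x => hu.deriv_xx x s hs.le) huxx
        (by simpa using hu.ux_add_one hs.le 0)
        (by rw [hu.integral_ux hs.le]; simpa [sub_eq_zero] using hu.periodic 0 s)
      have hcoercive : c * ∫ x in (0 : ℝ)..1, uxx x s ^ 2
          ≤ ∫ x in (0 : ℝ)..1, deriv F (ux x s) * uxx x s ^ 2 := by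
        rw [← intervalIntegral.integral_const_mul]
        exact integral_mono_on zero_le_one (Continuous.intervalIntegrable (by fun_prop) _ _)
          (Continuous.intervalIntegrable (by fun_prop) _ _)
          fun x _ => mul_le_mul_of_nonneg_right (hF' _) (sq_nonneg _)
      nlinarith [mul_le_mul_of_nonneg_left hpoincare hc.le]) ht
  refine (sqrt_le_sqrt hdecay).trans_eq ?_
  rw [sqrt_mul (exp_pos _).le, show -(8 * π ^ 2 * c * t) = -(4 * π ^ 2 * c * t) +
    -(4 * π ^ 2 * c * t) by ring, exp_add, sqrt_mul_self (exp_pos _).le]
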